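/- The polynomial system f(x,y) = x^6 + (44/31)y^3 - y, g(x,y) = y^14 + (44/31)x^3y^8 - xy^8 + α·x^133 has exactly 7 common roots (x,y) with x > 0 and y > 0, for any real α with 1936254 ≤ α ≤ 1936838. -/

import Mathlib

open Set

/-- `f` has at least `n` distinct zeros on `s`. -/
def HasZeros (s : Set ℝ) (f : ℝ → ℝ) (n : ℕ) : Prop :=
  ∃ t : Fin n → ℝ, StrictMono t ∧ ∀ i, t i ∈ s ∧ f (t i) = 0

theorem HasZeros.imp {s s' : Set ℝ} {f g : ℝ → ℝ} {n : ℕ} (h : HasZeros s f n)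
    (hfg : ∀ x ∈ s, f x = 0 → x ∈ s' ∧ g x = 0) : HasZeros s' g n := by
  obtain ⟨t, ht, h0⟩ := h
  exact ⟨t, ht, fun i => hfg _ (h0 i).1 (h0 i).2⟩

theorem HasZeros.comp {s s' : Set ℝ} {f g φ : ℝ → ℝ} {n : ℕ} (h : HasZeros s f n)
    (hφ : StrictMonoOn φ s) (hfg : ∀ x ∈ s, f x = 0 → φ x ∈ s' ∧ g (φ x) = 0) :
    HasZeros s' g n := by
  obtain ⟨t, ht, h0⟩ := h
  exact ⟨φ ∘ t, fun i j hij => hφ (h0 i).1 (h0 j).1 (ht hij),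
    fun i => hfg _ (h0 i).1 (h0 i).2⟩

/-- Rolle's theorem for a function whose derivative is `g` up to a nonvanishing factor. -/
theorem HasZeros.rolle {s : Set ℝ} (hs : s.OrdConnected) {f g c : ℝ → ℝ}
    (hf : ∀ x ∈ s, HasDerivAt f (c x * g x) x) (hc : ∀ x ∈ s, c x ≠ 0) {n : ℕ}
    (h : HasZeros s f (n + 1)) : HasZeros s g n := by
  obtain ⟨t, ht, h0⟩ := h
  have hsub (i : Fin n) : Icc (t i.castSucc) (t i.succ) ⊆ s :=
    hs.out (h0 _).1 (h0 _).1
  have key (i : Fin n) : ∃ u ∈ Ioo (t i.castSucc) (t i.succ), c u * g u = 0 :=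
    exists_hasDerivAt_eq_zero (ht i.castSucc_lt_succ)
      (fun x hx => (hf x (hsub i hx)).continuousAt.continuousWithinAt)
      ((h0 _).2.trans (h0 _).2.symm) fun x hx => hf x (hsub i (Ioo_subset_Icc_self hx))
  choose u hu hu0 using key
  have hus (i : Fin n) : u i ∈ s := hsub i (Ioo_subset_Icc_self (hu i))
  refine ⟨u, fun i j hij => ?_, fun i => ⟨hus i, ?_⟩⟩
  · have : t i.succ ≤ t j.castSucc := ht.monotone (Fin.succ_le_castSucc_iff.2 hij)
    linarith [(hu i).2, (hu j).1]
  · exact (mul_eq_zero.1 (hu0 i)).resolve_left (hc _ (hus i))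

theorem HasZeros.false_of_ne {s : Set ℝ} {f : ℝ → ℝ} {n : ℕ} (h : HasZeros s f (n + 1))
    (hf : ∀ x ∈ s, f x ≠ 0) : False := by
  obtain ⟨t, -, h0⟩ := h
  exact hf _ (h0 0).1 (h0 0).2

theorem hasZeros_of_encard_le {s : Set ℝ} {f : ℝ → ℝ} {n : ℕ}
    (h : (n : ℕ∞) ≤ {x | x ∈ s ∧ f x = 0}.encard) : HasZeros s f n := by
  obtain ⟨u, hu, hcard⟩ := exists_subset_encard_eq h
  have hfin : u.Finite := finite_of_encard_eq_coe hcard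
  have hc : hfin.toFinset.card = n := by
    rw [hfin.encard_eq_coe_toFinset_card] at hcard
    exact_mod_cast hcard
  exact ⟨hfin.toFinset.orderEmbOfFin hc, OrderEmbedding.strictMono _, fun i =>
    hu (hfin.mem_toFinset.1 (Finset.orderEmbOfFin_mem _ hc i))⟩

theorem HasZeros.le_encard {s : Set ℝ} {f : ℝ → ℝ} {n : ℕ} (h : HasZeros s f n) :
    (n : ℕ∞) ≤ {x | x ∈ s ∧ f x = 0}.encard := by
  obtain ⟨t, ht, h0⟩ := h
  calc (n : ℕ∞) = (range t).encard := by
        rw [← image_univ, ht.injective.encard_image, encard_univ]; simp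
    _ ≤ _ := encard_le_encard (by rintro _ ⟨i, rfl⟩; exact h0 i)

/-- The function `w ^ p * (1 - w) ^ r` with real exponents. -/
noncomputable def betaMonomial (p r w : ℝ) : ℝ := w ^ p * (1 - w) ^ r

theorem betaMonomial_pos (p r : ℝ) {w : ℝ} (hw : w ∈ Ioo (0 : ℝ) 1) : 0 < betaMonomial p r w :=
  mul_pos (Real.rpow_pos_of_pos hw.1 _) (Real.rpow_pos_of_pos (sub_pos.2 hw.2) _)

theorem betaMonomial_mul (p r p' r' : ℝ) {w : ℝ} (hw : w ∈ Ioo (0 : ℝ) 1) :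
    betaMonomial p r w * betaMonomial p' r' w = betaMonomial (p + p') (r + r') w := by
  simp only [betaMonomial]
  rw [Real.rpow_add hw.1, Real.rpow_add (sub_pos.2 hw.2)]
  ring

theorem betaMonomial_natCast (m n : ℕ) (w : ℝ) :
    betaMonomial m n w = w ^ m * (1 - w) ^ n := by
  simp only [betaMonomial, Real.rpow_natCast]

theorem betaMonomial_zero (w : ℝ) : betaMonomial 0 0 w = 1 := by
  simp [betaMonomial]

theorem hasDerivAt_betaMonomial_mul (p r : ℝ) {P : ℝ → ℝ} {P' w : ℝ} (hw : w ∈ Ioo (0 : ℝ) 1)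
    (hP : HasDerivAt P P' w) :
    HasDerivAt (fun w => betaMonomial p r w * P w)
      (betaMonomial (p - 1) (r - 1) w * ((p - (p + r) * w) * P w + w * (1 - w) * P')) w := by
  have hq : 0 < 1 - w := sub_pos.2 hw.2
  have h1 : HasDerivAt (fun w : ℝ => w ^ p) (p * w ^ (p - 1)) w :=
    Real.hasDerivAt_rpow_const (Or.inl hw.1.ne')
  have h2 : HasDerivAt (fun w : ℝ => (1 - w) ^ r) (-1 * r * (1 - w) ^ (r - 1)) w :=
    ((hasDerivAt_id w).const_sub 1).rpow_const (Or.inl hq.ne')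
  have e1 : w ^ p = w ^ (p - 1) * w := by
    rw [← Real.rpow_add_one hw.1.ne']; simp
  have e2 : (1 - w) ^ r = (1 - w) ^ (r - 1) * (1 - w) := by
    rw [← Real.rpow_add_one hq.ne']; simp
  refine ((h1.fun_mul h2).fun_mul hP).congr_deriv ?_
  simp only [betaMonomial, e1, e2]
  ring

theorem hasDerivAt_linear (a b w : ℝ) : HasDerivAt (fun w => a + b * w) b w := by
  simpa using ((hasDerivAt_id w).const_mul b).const_add a

/-- A polynomial with at most three zeros on the positive half-line, by Descartes' rule of signs. -/
def descartesPoly (t : ℝ) : ℝ :=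
  -17290 * t ^ 7 - 503016 * t ^ 6 + 5255145 * t ^ 5 + 37541016 * t ^ 4 - 133852986 * t ^ 3 -
    226380744 * t ^ 2 + 141391008 * t + 189411696

/-- Up to a nonvanishing factor, `descartesPoly` after the substitution `t = (3w - 1) / (1 - w)`. -/
def pulledBackPoly (w : ℝ) : ℝ :=
  -38874909150 * w ^ 7 + 177056392590 * w ^ 6 - 305531806734 * w ^ 5 + 244892653614 * w ^ 4 -
    83959222410 * w ^ 3 + 3313663290 * w ^ 2 + 3250142070 * w - 177896950

def cubicA (w : ℝ) : ℝ := -467775 * w ^ 3 + 1011087 * w ^ 2 - 590205 * w + 39445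

def cubicB (w : ℝ) : ℝ := -36936 * w ^ 3 + 54504 * w ^ 2 - 7608 * w - 1640

theorem hasDerivAt_poly₇ (a₀ a₁ a₂ a₃ a₄ a₅ a₆ a₇ t : ℝ) :
    HasDerivAt (fun t => a₀ + a₁ * t + a₂ * t ^ 2 + a₃ * t ^ 3 + a₄ * t ^ 4 + a₅ * t ^ 5 +
        a₆ * t ^ 6 + a₇ * t ^ 7)
      (a₁ + a₂ * (2 * t) + a₃ * (3 * t ^ 2) + a₄ * (4 * t ^ 3) + a₅ * (5 * t ^ 4) +
        a₆ * (6 * t ^ 5) + a₇ * (7 * t ^ 6)) t := by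
  have h (a : ℝ) (n : ℕ) : HasDerivAt (fun t : ℝ => a * t ^ n) (a * (n * t ^ (n - 1))) t :=
    (hasDerivAt_pow n t).const_mul a
  refine (((((((hasDerivAt_linear a₀ a₁ t).fun_add (h a₂ 2)).fun_add (h a₃ 3)).fun_add
    (h a₄ 4)).fun_add (h a₅ 5)).fun_add (h a₆ 6)).fun_add (h a₇ 7)).congr_deriv ?_
  norm_num

/-- A step in the proof of Descartes' rule: differentiate `t ^ (-k) * P` and multiply by
`t ^ (k + 1)`. -/
theorem HasZeros.descartes_step {P P' Q : ℝ → ℝ} {n : ℕ} (k : ℕ)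
    (hP : ∀ t, HasDerivAt P (P' t) t) (hQ : ∀ t, Q t = t * P' t - k * P t)
    (h : HasZeros (Ioi 0) P (n + 1)) : HasZeros (Ioi 0) Q n := by
  have h' : HasZeros (Ioi 0) (fun t => P t / t ^ k) (n + 1) :=
    h.imp fun x hx h0 => ⟨hx, by simp [h0]⟩
  refine h'.rolle ordConnected_Ioi (c := fun t => (t ^ (k + 1))⁻¹) (fun t ht => ?_)
    fun t ht => inv_ne_zero (pow_ne_zero _ (ne_of_gt ht))
  have ht0 : t ≠ 0 := ne_of_gt ht
  refine ((hP t).fun_div (hasDerivAt_pow k t) (pow_ne_zero k ht0)).congr_deriv ?_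
  rw [hQ]
  rcases k with _ | k
  · field_simp
    simp
  · simp only [Nat.add_sub_cancel]
    field_simp
    ring

theorem not_hasZeros_descartesPoly : ¬ HasZeros (Ioi 0) descartesPoly 4 := by
  intro h
  have h1 : HasZeros (Ioi 0) (fun t => -189411696 + 0 * t + (-226380744) * t ^ 2 +
      (-267705972) * t ^ 3 + 112623048 * t ^ 4 + 21020580 * t ^ 5 + (-2515080) * t ^ 6 +
      (-103740) * t ^ 7) 3 := by
    have h' : HasZeros (Ioi 0) (fun t => 189411696 + 141391008 * t + (-226380744) * t ^ 2 +
        (-133852986) * t ^ 3 + 37541016 * t ^ 4 + 5255145 * t ^ 5 + (-503016) * t ^ 6 +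
        (-17290) * t ^ 7) 4 :=
      h.imp fun x hx h0 => ⟨hx, by rw [← h0, descartesPoly]; ring⟩
    exact h'.descartes_step 1 (fun t => hasDerivAt_poly₇ _ _ _ _ _ _ _ _ t)
      fun t => by push_cast; ring
  have h2 : HasZeros (Ioi 0) (fun t => 568235088 + 0 * t + 226380744 * t ^ 2 + 0 * t ^ 3 +
      112623048 * t ^ 4 + 42041160 * t ^ 5 + (-7545240) * t ^ 6 + (-414960) * t ^ 7) 2 :=
    h1.descartes_step 3 (fun t => hasDerivAt_poly₇ _ _ _ _ _ _ _ _ t)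
      fun t => by push_cast; ring
  have h3 : HasZeros (Ioi 0) (fun t => -(829920 * t ^ 7 + 7545240 * t ^ 6 + 112623048 * t ^ 4 +
      679142232 * t ^ 2 + 2841175440)) 1 :=
    h2.descartes_step 5 (fun t => hasDerivAt_poly₇ _ _ _ _ _ _ _ _ t)
      fun t => by push_cast; ring
  refine h3.false_of_ne fun t ht => ?_
  have ht : 0 < t := ht
  exact ne_of_lt (neg_neg_of_pos (by positivity))

theorem not_hasZeros_pulledBackPoly : ¬ HasZeros (Ioo (1 / 3) 1) pulledBackPoly 4 := by
  intro h
  refine not_hasZeros_descartesPoly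
    (h.comp (φ := fun w => (3 * w - 1) / (1 - w)) ?_ fun w hw h0 => ?_)
  · intro x hx y hy hxy
    have h1 : 0 < 1 - x := sub_pos.2 hx.2
    have h2 : 0 < 1 - y := sub_pos.2 hy.2
    change (3 * x - 1) / (1 - x) < (3 * y - 1) / (1 - y)
    rw [div_lt_div_iff₀ h1 h2]
    nlinarith
  · have h1 : 0 < 1 - w := sub_pos.2 hw.2
    refine ⟨div_pos (by linarith [hw.1]) h1, ?_⟩
    have : 14 * (1 - w) ^ 7 * descartesPoly ((3 * w - 1) / (1 - w)) = pulledBackPoly w := by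
      simp only [descartesPoly, pulledBackPoly]
      field_simp
      ring
    rw [h0] at this
    exact (mul_eq_zero.1 this).resolve_left (by positivity)

theorem cubicB_pos {w : ℝ} (hw : w ∈ Ioo (1 / 3 : ℝ) 1) : 0 < cubicB w := by
  have h1 : 0 < w - 1 / 3 := sub_pos.2 hw.1
  have h2 : 0 < 1 - w := sub_pos.2 hw.2
  rw [cubicB]
  nlinarith [mul_pos h1 h2, mul_pos (mul_pos h1 h2) h1, mul_pos (mul_pos h1 h2) h2,
    pow_pos h1 3, pow_pos h2 3]

theorem mul_betaMonomial_pow_four {κ : ℝ} (hκ4 : κ ^ 4 = (31 / 44) ^ 15) {w : ℝ}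
    (hw : w ∈ Ioo (0 : ℝ) 1) :
    (κ * betaMonomial (11 / 4) (-1 / 2) w) ^ 4 * (1 - w) ^ 2 = (31 / 44) ^ 15 * w ^ 11 := by
  have h1 : betaMonomial (11 / 4) (-1 / 2) w ^ 4 = betaMonomial 11 (-2) w := by
    rw [pow_succ, pow_succ, pow_succ, pow_one, betaMonomial_mul _ _ _ _ hw,
      betaMonomial_mul _ _ _ _ hw, betaMonomial_mul _ _ _ _ hw]
    norm_num
  have h2 : (1 - w) ^ 2 = betaMonomial 0 2 w := by
    simpa using (betaMonomial_natCast 0 2 w).symm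
  have h3 : betaMonomial 11 0 w = w ^ 11 := by
    simpa using betaMonomial_natCast 11 0 w
  rw [mul_pow, hκ4, h1, h2, mul_assoc, betaMonomial_mul _ _ _ _ hw]
  norm_num [h3]

theorem cubic_combination_neg {κ : ℝ} (hκ : 0 < κ) (hκ4 : κ ^ 4 = (31 / 44) ^ 15) {w : ℝ}
    (hw : w ∈ Ioc (0 : ℝ) (1 / 3)) :
    κ * betaMonomial (11 / 4) (-1 / 2) w * cubicA w + cubicB w < 0 := by
  obtain ⟨h0, h1⟩ := hw
  have hw' : w ∈ Ioo (0 : ℝ) 1 := ⟨h0, by linarith⟩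
  have hK := mul_betaMonomial_pow_four hκ4 hw'
  have hK0 : 0 < κ * betaMonomial (11 / 4) (-1 / 2) w := mul_pos hκ (betaMonomial_pos _ _ hw')
  set K := κ * betaMonomial (11 / 4) (-1 / 2) w
  rcases le_total w (1 / 12) with h | h
  · have hK1 : K ≤ 1 / 25 := by
      by_contra! hlt
      have e1 : (1 / 25 : ℝ) ^ 4 * (11 / 12) ^ 2 ≤ K ^ 4 * (1 - w) ^ 2 := by
        gcongr
        linarith
      have e2 : (31 / 44 : ℝ) ^ 15 * w ^ 11 ≤ (31 / 44) ^ 15 * (1 / 12) ^ 11 := by gcongr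
      norm_num at e1 e2
      linarith
    have hA : cubicA w ≤ 39445 := by
      rw [cubicA]
      nlinarith [pow_pos h0 3]
    have hB : cubicB w ≤ -1640 := by
      rw [cubicB]
      nlinarith [pow_pos h0 3]
    nlinarith
  rcases le_total w (3 / 10) with h' | h'
  · have hm := mul_nonneg (sub_nonneg.2 h) (sub_nonneg.2 h')
    have hA : cubicA w < 0 := by
      rw [cubicA]
      nlinarith [mul_nonneg hm h0.le]
    have hB : cubicB w < 0 := by
      rw [cubicB]
      nlinarith [mul_nonneg hm h0.le]
    nlinarith
  · have hm := mul_nonneg (sub_nonneg.2 h') (sub_nonneg.2 h1)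
    have hK1 : 11 / 1000 ≤ K := by
      by_contra! hlt
      have e1 : K ^ 4 * (1 - w) ^ 2 ≤ (11 / 1000 : ℝ) ^ 4 * (7 / 10) ^ 2 := by
        gcongr
        · linarith
        · linarith
      have e2 : (31 / 44 : ℝ) ^ 15 * (3 / 10) ^ 11 ≤ (31 / 44) ^ 15 * w ^ 11 := by gcongr
      norm_num at e1 e2
      linarith
    have hA : cubicA w ≤ -59000 := by
      rw [cubicA]
      nlinarith [mul_nonneg hm h0.le]
    have hB : cubicB w ≤ 600 := by
      rw [cubicB]
      nlinarith [mul_nonneg hm h0.le]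
    nlinarith

theorem not_hasZeros_cubic_combination {κ : ℝ} (hκ : 0 < κ) (hκ4 : κ ^ 4 = (31 / 44) ^ 15) :
    ¬ HasZeros (Ioo 0 1)
      (fun w => κ * betaMonomial (11 / 4) (-1 / 2) w * cubicA w + cubicB w) 5 := by
  intro h
  have h1 : HasZeros (Ioo (1 / 3) 1)
      (fun w => κ * (betaMonomial (11 / 4) (-1 / 2) w * (cubicA w / cubicB w)) + 1) 5 := by
    refine h.imp fun w hw h0 => ?_
    have hw3 : w ∈ Ioo (1 / 3 : ℝ) 1 := by
      refine ⟨?_, hw.2⟩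
      by_contra! hle
      exact (cubic_combination_neg hκ hκ4 ⟨hw.1, hle⟩).ne h0
    refine ⟨hw3, ?_⟩
    have := (cubicB_pos hw3).ne'
    field_simp
    linarith
  refine not_hasZeros_pulledBackPoly (h1.rolle ordConnected_Ioo
    (c := fun w => κ * betaMonomial (7 / 4) (-3 / 2) w / cubicB w ^ 2) (fun w hw => ?_)
    fun w hw => ?_)
  · have hw' : w ∈ Ioo (0 : ℝ) 1 := ⟨by linarith [hw.1], hw.2⟩
    have hB0 := (cubicB_pos hw).ne'
    have hA : HasDerivAt cubicA (-590205 + 2022174 * w - 1403325 * w ^ 2) w := by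
      have := hasDerivAt_poly₇ 39445 (-590205) 1011087 (-467775) 0 0 0 0 w
      refine (this.congr_of_eventuallyEq (.of_forall fun x => ?_)).congr_deriv ?_
      · simp only [cubicA]; ring
      · ring
    have hB : HasDerivAt cubicB (-7608 + 109008 * w - 110808 * w ^ 2) w := by
      have := hasDerivAt_poly₇ (-1640) (-7608) 54504 (-36936) 0 0 0 0 w
      refine (this.congr_of_eventuallyEq (.of_forall fun x => ?_)).congr_deriv ?_
      · simp only [cubicB]; ring
      · ring
    refine (((hasDerivAt_betaMonomial_mul (11 / 4) (-1 / 2) hw'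
      (hA.fun_div hB hB0)).const_mul κ).add_const 1).congr_deriv ?_
    norm_num only
    field_simp
    simp only [cubicA, cubicB, pulledBackPoly]
    ring
  · have hw' : w ∈ Ioo (0 : ℝ) 1 := ⟨by linarith [hw.1], hw.2⟩
    have := cubicB_pos hw
    have := betaMonomial_pos (7 / 4) (-3 / 2) hw'
    positivity

theorem not_hasZeros_three_terms {k₁ k₂ : ℝ} (hk₁ : 0 < k₁) (hk₂ : 0 < k₂)
    (hk : (k₁ / k₂) ^ 4 = (31 / 44) ^ 15) :
    ¬ HasZeros (Ioo 0 1) (fun w => k₁ * (betaMonomial (35 / 12) (-1 / 6) w * (49 + -315 * w)) +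
      k₂ * (betaMonomial (1 / 6) (1 / 3) w * (82 + -342 * w)) + (-84 + 348 * w)) 7 := by
  intro h
  have h1 : HasZeros (Ioo 0 1) (fun w =>
      k₁ * (betaMonomial (23 / 12) (-7 / 6) w *
        (1715 / 12 + (-2737 / 2 * w + 4725 / 4 * w ^ 2))) +
      k₂ * (betaMonomial (-5 / 6) (-2 / 3) w *
        (41 / 3 + (-440 * w + 513 * w ^ 2))) + 348) 6 := by
    refine h.rolle ordConnected_Ioo (c := fun _ => 1) (fun w hw => ?_) fun _ _ => one_ne_zero
    refine ((((hasDerivAt_betaMonomial_mul _ _ hw (hasDerivAt_linear 49 (-315) w)).const_mul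
      k₁).fun_add ((hasDerivAt_betaMonomial_mul _ _ hw (hasDerivAt_linear 82 (-342) w)).const_mul
      k₂)).fun_add (hasDerivAt_linear (-84) 348 w)).congr_deriv ?_
    norm_num only
    ring
  have hquad (a b c w : ℝ) :
      HasDerivAt (fun w => a + (b * w + c * w ^ 2)) (b + 2 * c * w) w := by
    refine (((hasDerivAt_poly₇ a b c 0 0 0 0 0 w)).congr_of_eventuallyEq
      (.of_forall fun x => ?_)).congr_deriv ?_ <;> ring
  refine not_hasZeros_cubic_combination (div_pos hk₁ hk₂) hk (h1.rolle ordConnected_Ioo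
    (c := fun w => k₂ / 144 * betaMonomial (-11 / 6) (-5 / 3) w) (fun w hw => ?_) fun w hw => ?_)
  · refine ((((hasDerivAt_betaMonomial_mul _ _ hw (hquad _ _ _ w)).const_mul
      k₁).fun_add ((hasDerivAt_betaMonomial_mul _ _ hw (hquad _ _ _ w)).const_mul
      k₂)).add_const 348).congr_deriv ?_
    have e : betaMonomial (11 / 12) (-13 / 6) w =
        betaMonomial (-11 / 6) (-5 / 3) w * betaMonomial (11 / 4) (-1 / 2) w := by
      rw [betaMonomial_mul _ _ _ _ hw]
      norm_num
    norm_num only at e ⊢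
    rw [e]
    simp only [cubicA, cubicB]
    field_simp
    ring
  · have := betaMonomial_pos (-11 / 6) (-5 / 3) hw
    positivity

theorem not_hasZeros_four_terms {k₁ k₂ : ℝ} (hk₁ : 0 < k₁) (hk₂ : 0 < k₂)
    (hk : (k₁ / k₂) ^ 4 = (31 / 44) ^ 15) (β : ℝ) :
    ¬ HasZeros (Ioo 0 1) (fun w => k₁ * betaMonomial (35 / 12) (-1 / 6) w +
      k₂ * betaMonomial (1 / 6) (1 / 3) w + β * (w ^ 7 * (1 - w) ^ 22) - 1) 8 := by
  intro h
  have h1 : HasZeros (Ioo 0 1) (fun w => k₁ * (betaMonomial (-49 / 12) (-133 / 6) w * 1) +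
      k₂ * (betaMonomial (-41 / 6) (-65 / 3) w * 1) + -1 * (betaMonomial (-7) (-22) w * 1) + β)
      8 := by
    refine h.imp fun w hw h0 => ⟨hw, ?_⟩
    have e1 : betaMonomial (-49 / 12) (-133 / 6) w =
        betaMonomial (-7) (-22) w * betaMonomial (35 / 12) (-1 / 6) w := by
      rw [betaMonomial_mul _ _ _ _ hw]
      norm_num
    have e2 : betaMonomial (-41 / 6) (-65 / 3) w =
        betaMonomial (-7) (-22) w * betaMonomial (1 / 6) (1 / 3) w := by
      rw [betaMonomial_mul _ _ _ _ hw]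
      norm_num
    have e3 : betaMonomial (-7) (-22) w * (w ^ 7 * (1 - w) ^ 22) = 1 := by
      have := betaMonomial_natCast 7 22 w
      push_cast at this
      rw [← this, betaMonomial_mul _ _ _ _ hw, ← betaMonomial_zero w]
      norm_num
    rw [e1, e2]
    linear_combination betaMonomial (-7) (-22) w * h0 - β * e3
  refine not_hasZeros_three_terms hk₁ hk₂ hk (h1.rolle ordConnected_Ioo
    (c := fun w => -1 / 12 * betaMonomial (-8) (-23) w) (fun w hw => ?_) fun w hw => ?_)
  · have hd (p r : ℝ) := hasDerivAt_betaMonomial_mul p r hw (hasDerivAt_const w (1 : ℝ))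
    refine (((((hd _ _).const_mul k₁).fun_add ((hd _ _).const_mul k₂)).fun_add
      ((hd _ _).const_mul (-1))).add_const β).congr_deriv ?_
    have e1 : betaMonomial (-61 / 12) (-139 / 6) w =
        betaMonomial (-8) (-23) w * betaMonomial (35 / 12) (-1 / 6) w := by
      rw [betaMonomial_mul _ _ _ _ hw]
      norm_num
    have e2 : betaMonomial (-47 / 6) (-68 / 3) w =
        betaMonomial (-8) (-23) w * betaMonomial (1 / 6) (1 / 3) w := by
      rw [betaMonomial_mul _ _ _ _ hw]
      norm_num
    norm_num only at e1 e2 ⊢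
    rw [e1, e2]
    ring
  · have := betaMonomial_pos (-8) (-23) hw
    simp [this.ne']

/-- The ordinates of the points of the curve `x ^ 6 + (44 / 31) * y ^ 3 - y = 0` in the open
positive quadrant. -/
def ordinates : Set ℝ := {y | 0 < y ∧ 0 < 1 - 44 / 31 * y ^ 2}

/-- The abscissa of the point of the curve `x ^ 6 + (44 / 31) * y ^ 3 - y = 0` with ordinate
`y`. -/
noncomputable def abscissa (y : ℝ) : ℝ := (y * (1 - 44 / 31 * y ^ 2)) ^ (1 / 6 : ℝ)

/-- The second equation, divided by `x * y ^ 8`, restricted to the first curve. -/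
noncomputable def restriction (α y : ℝ) : ℝ :=
  y ^ 6 / abscissa y + 44 / 31 * abscissa y ^ 2 + α * (y ^ 14 * (1 - 44 / 31 * y ^ 2) ^ 22) - 1

theorem abscissa_pos {y : ℝ} (hy : y ∈ ordinates) : 0 < abscissa y :=
  Real.rpow_pos_of_pos (mul_pos hy.1 hy.2) _

theorem abscissa_pow {y : ℝ} (hy : y ∈ ordinates) :
    abscissa y ^ 6 = y * (1 - 44 / 31 * y ^ 2) := by
  rw [abscissa, ← Real.rpow_mul_natCast (mul_pos hy.1 hy.2).le]
  norm_num

theorem solutions_eq_image (α : ℝ) :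
    {p : ℝ × ℝ | 0 < p.1 ∧ 0 < p.2 ∧
        p.1 ^ 6 + (44 / 31) * p.2 ^ 3 - p.2 = 0 ∧
        p.2 ^ 14 + (44 / 31) * p.1 ^ 3 * p.2 ^ 8 - p.1 * p.2 ^ 8 + α * p.1 ^ 133 = 0} =
      (fun y => (abscissa y, y)) '' {y | y ∈ ordinates ∧ restriction α y = 0} := by
  have key {x y : ℝ} (hx : 0 < x) (hy : 0 < y) (hxy : x ^ 6 = y * (1 - 44 / 31 * y ^ 2)) :
      y ^ 14 + (44 / 31) * x ^ 3 * y ^ 8 - x * y ^ 8 + α * x ^ 133 =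
        x * y ^ 8 * (y ^ 6 / x + 44 / 31 * x ^ 2 +
          α * (y ^ 14 * (1 - 44 / 31 * y ^ 2) ^ 22) - 1) := by
    have : x ^ 133 = x * (y * (1 - 44 / 31 * y ^ 2)) ^ 22 := by rw [← hxy]; ring
    rw [this]
    field_simp
    ring
  ext ⟨x, y⟩
  simp only [mem_ofPred_eq, mem_image, Prod.mk.injEq]
  constructor
  · rintro ⟨hx, hy, hf, hg⟩
    have hxy : x ^ 6 = y * (1 - 44 / 31 * y ^ 2) := by linear_combination hf
    have hmem : y ∈ ordinates := ⟨hy, pos_of_mul_pos_right (hxy ▸ pow_pos hx 6) hy.le⟩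
    have hX : abscissa y = x :=
      (pow_left_inj₀ (abscissa_pos hmem).le hx.le (by norm_num)).1
        ((abscissa_pow hmem).trans hxy.symm)
    refine ⟨y, ⟨hmem, ?_⟩, hX, rfl⟩
    rw [key hx hy hxy] at hg
    rw [restriction, hX]
    exact (mul_eq_zero.1 hg).resolve_left (by positivity)
  · rintro ⟨y', ⟨hmem, h0⟩, hX, rfl⟩
    have hx : 0 < x := hX ▸ abscissa_pos hmem
    have hxy := abscissa_pow hmem
    rw [hX] at hxy
    refine ⟨hx, hmem.1, by linear_combination hxy, ?_⟩
    rw [restriction, hX] at h0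
    rw [key hx hmem.1 hxy, h0, mul_zero]

theorem restriction_eq_four_terms (α : ℝ) {y : ℝ} (hy : y ∈ ordinates) :
    restriction α y = (44 / 31) ^ (-35 / 12 : ℝ) * betaMonomial (35 / 12) (-1 / 6) (44 / 31 * y ^ 2)
      + (44 / 31) ^ (5 / 6 : ℝ) * betaMonomial (1 / 6) (1 / 3) (44 / 31 * y ^ 2) +
      α * (31 / 44) ^ 7 * ((44 / 31 * y ^ 2) ^ 7 * (1 - 44 / 31 * y ^ 2) ^ 22) - 1 := by
  obtain ⟨h0, h1⟩ := hy
  have ha : (0 : ℝ) < 44 / 31 := by norm_num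
  have hsq (p : ℝ) : (44 / 31 * y ^ 2) ^ p = (44 / 31) ^ p * y ^ (2 * p) := by
    rw [Real.mul_rpow ha.le (by positivity), ← Real.rpow_natCast_mul h0.le]
    norm_num
  have hX (r : ℝ) : abscissa y ^ r = y ^ (1 / 6 * r) * (1 - 44 / 31 * y ^ 2) ^ (1 / 6 * r) := by
    rw [abscissa, ← Real.rpow_mul (mul_pos h0 h1).le, Real.mul_rpow h0.le h1.le]
  have e1 : y ^ 6 / abscissa y = (44 / 31) ^ (-35 / 12 : ℝ) *
      betaMonomial (35 / 12) (-1 / 6) (44 / 31 * y ^ 2) := by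
    rw [div_eq_mul_inv, ← Real.rpow_neg_one, hX, betaMonomial, hsq, ← mul_assoc, ← mul_assoc,
      ← mul_assoc, ← Real.rpow_add ha, ← Real.rpow_natCast, ← Real.rpow_add h0]
    norm_num
  have e2 : 44 / 31 * abscissa y ^ 2 = (44 / 31) ^ (5 / 6 : ℝ) *
      betaMonomial (1 / 6) (1 / 3) (44 / 31 * y ^ 2) := by
    rw [← Real.rpow_natCast (abscissa y), hX, betaMonomial, hsq, ← mul_assoc, ← mul_assoc,
      ← mul_assoc, ← Real.rpow_add ha]
    norm_num
  rw [restriction, e1, e2]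
  ring

theorem not_hasZeros_restriction (α : ℝ) : ¬ HasZeros ordinates (restriction α) 8 := by
  intro h
  have ha : (0 : ℝ) < 44 / 31 := by norm_num
  have hk : ((44 / 31 : ℝ) ^ (-35 / 12 : ℝ) / (44 / 31) ^ (5 / 6 : ℝ)) ^ 4 = (31 / 44) ^ 15 := by
    rw [← Real.rpow_sub ha, ← Real.rpow_mul_natCast ha.le,
      show (31 / 44 : ℝ) = (44 / 31)⁻¹ by norm_num, inv_pow, ← Real.rpow_natCast,
      ← Real.rpow_neg ha.le]
    norm_num
  refine not_hasZeros_four_terms (Real.rpow_pos_of_pos ha _) (Real.rpow_pos_of_pos ha _) hk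
    (α * (31 / 44) ^ 7) (h.comp (φ := fun y => 44 / 31 * y ^ 2) ?_ fun y hy h0 => ?_)
  · intro x hx y _ hxy
    have := hx.1
    change 44 / 31 * x ^ 2 < 44 / 31 * y ^ 2
    gcongr
  · have := hy.1
    refine ⟨⟨by positivity, by linarith [hy.2]⟩, ?_⟩
    rw [← h0, restriction_eq_four_terms α hy]

theorem continuousOn_restriction (α : ℝ) : ContinuousOn (restriction α) ordinates := by
  have hX : ContinuousOn abscissa ordinates :=
    ContinuousOn.rpow_const (by fun_prop) fun y hy => Or.inl (mul_pos hy.1 hy.2).ne'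
  have hdiv : ContinuousOn (fun y => y ^ 6 / abscissa y) ordinates :=
    ContinuousOn.div (by fun_prop) hX fun y hy => (abscissa_pos hy).ne'
  unfold restriction
  fun_prop

theorem le_abscissa {y l : ℝ} (hy : y ∈ ordinates) (h : l ^ 6 ≤ y * (1 - 44 / 31 * y ^ 2)) :
    l ≤ abscissa y :=
  le_of_pow_le_pow_left₀ (by norm_num) (abscissa_pos hy).le (h.trans_eq (abscissa_pow hy).symm)

theorem abscissa_le {y u : ℝ} (hy : y ∈ ordinates) (hu : 0 ≤ u)
    (h : y * (1 - 44 / 31 * y ^ 2) ≤ u ^ 6) : abscissa y ≤ u :=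
  le_of_pow_le_pow_left₀ (by norm_num) hu ((abscissa_pow hy).trans_le h)

theorem restriction_neg {α y : ℝ} (α' l u : ℝ) (hα : α ≤ α') (hy : y ∈ ordinates) (hl : 0 < l)
    (hu : 0 ≤ u) (hly : l ^ 6 ≤ y * (1 - 44 / 31 * y ^ 2))
    (hyu : y * (1 - 44 / 31 * y ^ 2) ≤ u ^ 6)
    (h : y ^ 6 / l + 44 / 31 * u ^ 2 + α' * (y ^ 14 * (1 - 44 / 31 * y ^ 2) ^ 22) - 1 < 0) :
    restriction α y < 0 := by
  have h1 := le_abscissa hy hly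
  have h2 := abscissa_le hy hu hyu
  have h3 := abscissa_pos hy
  have h4 := hy.1
  have h5 := hy.2
  refine lt_of_le_of_lt ?_ h
  rw [restriction]
  gcongr

theorem restriction_pos {α y : ℝ} (α' l u : ℝ) (hα : α' ≤ α) (hy : y ∈ ordinates) (hl : 0 ≤ l)
    (hu : 0 ≤ u) (hly : l ^ 6 ≤ y * (1 - 44 / 31 * y ^ 2))
    (hyu : y * (1 - 44 / 31 * y ^ 2) ≤ u ^ 6)
    (h : 0 < y ^ 6 / u + 44 / 31 * l ^ 2 + α' * (y ^ 14 * (1 - 44 / 31 * y ^ 2) ^ 22) - 1) :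
    0 < restriction α y := by
  have h1 := le_abscissa hy hly
  have h2 := abscissa_le hy hu hyu
  have h3 := abscissa_pos hy
  have h4 := hy.1
  have h5 := hy.2
  refine lt_of_lt_of_le h ?_
  rw [restriction]
  gcongr

theorem ordConnected_ordinates : ordinates.OrdConnected := by
  refine ⟨fun x hx y hy z hz => ⟨hx.1.trans_le hz.1, hy.2.trans_le ?_⟩⟩
  have := hx.1.trans_le hz.1
  have := hz.2
  gcongr

/-- A continuous function that changes sign between consecutive points of a strictly increasing
sequence of length `n + 1` has at least `n` zeros. -/
theorem hasZeros_of_sign_changes {s : Set ℝ} (hs : s.OrdConnected) {f : ℝ → ℝ}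
    (hf : ContinuousOn f s) {n : ℕ} {z : Fin (n + 1) → ℝ} (hz : StrictMono z)
    (hzs : ∀ i, z i ∈ s) (hsign : ∀ i : Fin n, f (z i.castSucc) * f (z i.succ) < 0) :
    HasZeros s f n := by
  have key (i : Fin n) : ∃ u ∈ Ioo (z i.castSucc) (z i.succ), f u = 0 := by
    have hlt := hz i.castSucc_lt_succ
    have hc : ContinuousOn f (Icc (z i.castSucc) (z i.succ)) := hf.mono (hs.out (hzs _) (hzs _))
    rcases mul_neg_iff.1 (hsign i) with h | h
    · exact intermediate_value_Ioo' hlt.le hc ⟨h.2, h.1⟩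
    · exact intermediate_value_Ioo hlt.le hc h
  choose u hu hu0 using key
  refine ⟨u, fun i j hij => ?_,
    fun i => ⟨hs.out (hzs _) (hzs _) (Ioo_subset_Icc_self (hu i)), hu0 i⟩⟩
  have : z i.succ ≤ z j.castSucc := hz.monotone (Fin.succ_le_castSucc_iff.2 hij)
  linarith [(hu i).2, (hu j).1]

theorem hasZeros_restriction {α : ℝ} (h₁ : 1936254 ≤ α) (h₂ : α ≤ 1936838) :
    HasZeros ordinates (restriction α) 7 := by
  have mem (y : ℝ) (h0 : 0 < y) (h1 : y ≤ 0.83) : y ∈ ordinates := ⟨h0, by nlinarith⟩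
  have s0 : restriction α 0.5 < 0 := by
    refine restriction_neg _ 0.828145 0.828145001 h₂ (mem _ ?_ ?_) ?_ ?_ ?_ ?_ ?_ <;> norm_num
  have s1 : 0 < restriction α 0.512857 := by
    refine restriction_pos _ 0.8276374335128 0.8276374335129 h₁ (mem _ ?_ ?_) ?_ ?_ ?_ ?_ ?_ <;>
      norm_num
  have s2 : restriction α 0.521305 < 0 := by
    refine restriction_neg _ 0.827134441459 0.8271344414591 h₂ (mem _ ?_ ?_) ?_ ?_ ?_ ?_ ?_ <;>
      norm_num
  have s3 : 0 < restriction α 0.62 := by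
    refine restriction_pos _ 0.809664321 0.809664322 h₁ (mem _ ?_ ?_) ?_ ?_ ?_ ?_ ?_ <;> norm_num
  have s4 : restriction α 0.73 < 0 := by
    refine restriction_neg _ 0.74990749 0.749907491 h₂ (mem _ ?_ ?_) ?_ ?_ ?_ ?_ ?_ <;> norm_num
  have s5 : 0 < restriction α 0.75 := by
    refine restriction_pos _ 0.729899833 0.729899834 h₁ (mem _ ?_ ?_) ?_ ?_ ?_ ?_ ?_ <;> norm_num
  have s6 : restriction α 0.8 < 0 := by
    refine restriction_neg _ 0.64690589 0.646905891 h₂ (mem _ ?_ ?_) ?_ ?_ ?_ ?_ ?_ <;> norm_num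
  have s7 : 0 < restriction α 0.83 := by
    refine restriction_pos _ 0.513956319 0.51395632 h₁ (mem _ ?_ ?_) ?_ ?_ ?_ ?_ ?_ <;> norm_num
  refine hasZeros_of_sign_changes ordConnected_ordinates (continuousOn_restriction α)
    (z := ![0.5, 0.512857, 0.521305, 0.62, 0.73, 0.75, 0.8, 0.83]) ?_ ?_ ?_
  · rw [Fin.strictMono_iff_lt_succ]
    intro i
    fin_cases i <;> simp <;> norm_num
  · intro i
    fin_cases i <;> exact mem _ (by norm_num) (by norm_num)
  · intro i
    fin_cases i
    · exact mul_neg_of_neg_of_pos s0 s1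
    · exact mul_neg_of_pos_of_neg s1 s2
    · exact mul_neg_of_neg_of_pos s2 s3
    · exact mul_neg_of_pos_of_neg s3 s4
    · exact mul_neg_of_neg_of_pos s4 s5
    · exact mul_neg_of_pos_of_neg s5 s6
    · exact mul_neg_of_neg_of_pos s6 s7

theorem stmt0 (α : ℝ) (hα : 1936254 ≤ α ∧ α ≤ 1936838) :
    ({p : ℝ × ℝ | 0 < p.1 ∧ 0 < p.2 ∧
        p.1 ^ 6 + (44 / 31) * p.2 ^ 3 - p.2 = 0 ∧
        p.2 ^ 14 + (44 / 31) * p.1 ^ 3 * p.2 ^ 8 - p.1 * p.2 ^ 8 + α * p.1 ^ 133 = 0}).Finite ∧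
    ({p : ℝ × ℝ | 0 < p.1 ∧ 0 < p.2 ∧
        p.1 ^ 6 + (44 / 31) * p.2 ^ 3 - p.2 = 0 ∧
        p.2 ^ 14 + (44 / 31) * p.1 ^ 3 * p.2 ^ 8 - p.1 * p.2 ^ 8 + α * p.1 ^ 133 = 0}).ncard = 7 := by
  have hinj : Function.Injective fun y => (abscissa y, y) := fun _ _ h => (Prod.mk.inj h).2
  have h7 : ({y | y ∈ ordinates ∧ restriction α y = 0}).encard = 7 := by
    refine le_antisymm ?_ (hasZeros_restriction hα.1 hα.2).le_encard
    by_contra! hlt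
    exact not_hasZeros_restriction α (hasZeros_of_encard_le (Order.add_one_le_of_lt hlt))
  rw [← hinj.encard_image, ← solutions_eq_image] at h7
  exact ⟨finite_of_encard_eq_coe h7, by rw [ncard, h7]; rfl⟩
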